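/- Generalized Gronwall lemma: let y be a nonnegative continuous integrable function on (0,T] satisfying y(t) ≤ Σ_{i=1}^{l} a_i t^{-α_i} + Σ_{j=1}^{m} b_j ∫₀ᵗ (t−s)^{-β_j} y(s) ds for all 0 < t ≤ T, where a_i > 0, b_j > 0, 0 ≤ α_i < 1, 0 ≤ β_j < 1. Then there exists a constant C depending only on the α_i and β_j such that y(t) ≤ C (Σ_{i=1}^{l} a_i t^{-α_i}) (1 + B_{n_β+1}(t) e^{C B_{n_β+1}(t)}) Σ_{k=0}^{n_β} B_k(t) for all 0 < t ≤ T, where β = max_j β_j, n_β = ⌊β/(1−β)⌋ + 1, b_j(t) = b_j t^{1−β_j}, and B_k(t) = (Σ_{j=1}^m b_j(t))^k. -/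

import Mathlib

open MeasureTheory

noncomputable section

/-- `n_β = ⌊β/(1−β)⌋ + 1` where `β = max_j β_j`. -/
def nBeta {m : ℕ} (β : Fin (m + 1) → ℝ) : ℕ :=
  let b := Finset.univ.sup' ⟨0, Finset.mem_univ 0⟩ β
  Nat.floor (b / (1 - b)) + 1

/-- The integral of the weakly singular kernel `(s - r) ^ (-p)` over `(r, u)`. -/
lemma lintegral_Ioo_sub_rpow_neg {p r u : ℝ} (hp : p < 1) (hr : r ≤ u) :
    ∫⁻ s in Set.Ioo r u, ENNReal.ofReal ((s - r) ^ (-p)) =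
      ENNReal.ofReal ((u - r) ^ (1 - p) / (1 - p)) := by
  have hint : IntegrableOn (fun s : ℝ => (s - r) ^ (-p)) (Set.Ioo r u) := by
    rw [← intervalIntegrable_iff_integrableOn_Ioo_of_le hr]
    simpa using (intervalIntegral.intervalIntegrable_rpow' (a := 0) (b := u - r)
      (by linarith : -1 < -p)).comp_sub_right r
  rw [← ofReal_integral_eq_lintegral_ofReal hint]
  · congr 1
    rw [← integral_Ioc_eq_integral_Ioo, ← intervalIntegral.integral_of_le hr,
      intervalIntegral.integral_comp_sub_right (fun x : ℝ => x ^ (-p)),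
      integral_rpow (Or.inl (by linarith)), sub_self, Real.zero_rpow (by linarith), sub_zero,
      neg_add_eq_sub]
  · filter_upwards [ae_restrict_mem measurableSet_Ioo] with s hs
    exact Real.rpow_nonneg (by linarith [hs.1]) _

lemma integrableOn_Ioo_const_sub_rpow_neg {q r u : ℝ} (hq : q < 1) (hr : r ≤ u) :
    IntegrableOn (fun s : ℝ => (u - s) ^ (-q)) (Set.Ioo r u) := by
  rw [← intervalIntegrable_iff_integrableOn_Ioo_of_le hr]
  simpa using ((intervalIntegral.intervalIntegrable_rpow' (a := 0) (b := u - r)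
    (by linarith : -1 < -q)).comp_sub_left u).symm

lemma lintegral_Ioo_const_sub_rpow_neg {q r u : ℝ} (hq : q < 1) (hr : r ≤ u) :
    ∫⁻ s in Set.Ioo r u, ENNReal.ofReal ((u - s) ^ (-q)) =
      ENNReal.ofReal ((u - r) ^ (1 - q) / (1 - q)) := by
  rw [← ofReal_integral_eq_lintegral_ofReal (integrableOn_Ioo_const_sub_rpow_neg hq hr)]
  · congr 1
    rw [← integral_Ioc_eq_integral_Ioo, ← intervalIntegral.integral_of_le hr,
      intervalIntegral.integral_comp_sub_left (fun x : ℝ => x ^ (-q)), sub_self,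
      integral_rpow (Or.inl (by linarith)), Real.zero_rpow (by linarith), sub_zero,
      neg_add_eq_sub]
  · filter_upwards [ae_restrict_mem measurableSet_Ioo] with s hs
    exact Real.rpow_nonneg (by linarith [hs.2]) _

/-- In `x + y`, the larger of the two summands is at least half of the sum. -/
lemma rpow_neg_mul_rpow_neg_le {p q x y : ℝ} (hp : 0 ≤ p) (hq : 0 ≤ q) (hx : 0 < x) (hy : 0 < y) :
    y ^ (-q) * x ^ (-p) ≤
      ((x + y) / 2) ^ (-p) * y ^ (-q) + ((x + y) / 2) ^ (-q) * x ^ (-p) := by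
  have hxp := Real.rpow_nonneg hx.le (-p)
  have hyq := Real.rpow_nonneg hy.le (-q)
  have hu : 0 < (x + y) / 2 := by positivity
  have hup := Real.rpow_nonneg hu.le (-p)
  have huq := Real.rpow_nonneg hu.le (-q)
  rcases le_total x y with h | h
  · have := Real.rpow_le_rpow_of_nonpos hu (by linarith : (x + y) / 2 ≤ y)
      (by linarith : -q ≤ 0)
    nlinarith [mul_nonneg hup hyq]
  · have := Real.rpow_le_rpow_of_nonpos hu (by linarith : (x + y) / 2 ≤ x)
      (by linarith : -p ≤ 0)
    nlinarith [mul_nonneg huq hxp]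

/-- Euler's beta integral over a subinterval `(r, 1)` of the unit interval is controlled by the
singularity at the right endpoint. -/
lemma exists_lintegral_beta_le {p q : ℝ} (hp0 : 0 ≤ p) (hp : p < 1) (hq0 : 0 ≤ q) (hq : q < 1) :
    ∃ D > 0, ∀ r : ℝ, 0 ≤ r → r < 1 →
      ∫⁻ s in Set.Ioo r 1, ENNReal.ofReal ((1 - s) ^ (-q) * (s - r) ^ (-p)) ≤
        ENNReal.ofReal (D * (1 - r) ^ (-q)) := by
  have hp1 : 0 < 1 - p := by linarith
  have hq1 : 0 < 1 - q := by linarith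
  refine ⟨2 ^ p / (1 - q) + 2 ^ q / (1 - p), by positivity, fun r hr0 hr1 => ?_⟩
  have hu : 0 < 1 - r := by linarith
  have hu2 : 0 < (1 - r) / 2 := by linarith
  calc ∫⁻ s in Set.Ioo r 1, ENNReal.ofReal ((1 - s) ^ (-q) * (s - r) ^ (-p))
      ≤ ∫⁻ s in Set.Ioo r 1,
          (ENNReal.ofReal (((1 - r) / 2) ^ (-p)) * ENNReal.ofReal ((1 - s) ^ (-q)) +
            ENNReal.ofReal (((1 - r) / 2) ^ (-q)) * ENNReal.ofReal ((s - r) ^ (-p))) := by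
        refine setLIntegral_mono' measurableSet_Ioo fun s hs => ?_
        have h1 : 0 < s - r := by linarith [hs.1]
        have h2 : 0 < 1 - s := by linarith [hs.2]
        rw [← ENNReal.ofReal_mul (by positivity), ← ENNReal.ofReal_mul (by positivity),
          ← ENNReal.ofReal_add (by positivity) (by positivity)]
        refine ENNReal.ofReal_le_ofReal ?_
        simpa using rpow_neg_mul_rpow_neg_le hp0 hq0 h1 h2
    _ = ENNReal.ofReal (((1 - r) / 2) ^ (-p) * ((1 - r) ^ (1 - q) / (1 - q)) +
          ((1 - r) / 2) ^ (-q) * ((1 - r) ^ (1 - p) / (1 - p))) := by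
        rw [lintegral_add_left (by fun_prop), lintegral_const_mul _ (by fun_prop),
          lintegral_const_mul _ (by fun_prop), lintegral_Ioo_sub_rpow_neg hp hr1.le,
          lintegral_Ioo_const_sub_rpow_neg hq hr1.le, ← ENNReal.ofReal_mul (by positivity),
          ← ENNReal.ofReal_mul (by positivity), ← ENNReal.ofReal_add (by positivity) (by positivity)]
    _ ≤ _ := by
        refine ENNReal.ofReal_le_ofReal ?_
        have e1 : ((1 - r) / 2) ^ (-p) * (1 - r) ^ (1 - q) =
            2 ^ p * ((1 - r) ^ (-q) * (1 - r) ^ (1 - p)) := by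
          rw [Real.div_rpow hu.le zero_le_two, Real.rpow_neg zero_le_two, div_inv_eq_mul,
            mul_right_comm, ← Real.rpow_add hu, ← Real.rpow_add hu, mul_comm]
          ring_nf
        have e2 : ((1 - r) / 2) ^ (-q) * (1 - r) ^ (1 - p) =
            2 ^ q * ((1 - r) ^ (-q) * (1 - r) ^ (1 - p)) := by
          rw [Real.div_rpow hu.le zero_le_two, Real.rpow_neg zero_le_two, div_inv_eq_mul]
          ring
        have h1 : (1 - r) ^ (1 - p) ≤ 1 := Real.rpow_le_one hu.le (by linarith) hp1.le
        calc _ = (2 ^ p / (1 - q) + 2 ^ q / (1 - p)) * (1 - r) ^ (-q) * (1 - r) ^ (1 - p) := by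
              rw [← mul_div_assoc, ← mul_div_assoc, e1, e2]
              ring
          _ ≤ _ := mul_le_of_le_one_right (by positivity) h1

lemma Real.exp_neg_le_rpow_neg {θ x : ℝ} (h0 : 0 ≤ θ) (h1 : θ ≤ 1) (hx : 0 < x) :
    Real.exp (-x) ≤ x ^ (-θ) := by
  rw [Real.exp_neg, Real.rpow_neg hx.le]
  refine inv_anti₀ (Real.rpow_pos_of_pos hx θ) ?_
  rcases le_total x 1 with h | h
  · exact (Real.rpow_le_one hx.le h h0).trans (Real.one_le_exp hx.le)
  · calc x ^ θ ≤ x ^ (1 : ℝ) := Real.rpow_le_rpow_of_exponent_le h h1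
      _ ≤ Real.exp x := by rw [Real.rpow_one]; linarith [Real.add_one_le_exp x]

/-- Against the weight `(1 - r) ^ (-β) * exp (-L * r)`, the Volterra operator with kernel
`(s - r) ^ (-β)` has norm at most `D * L ^ (-θ)`. -/
lemma lintegral_weight_mul_volterra_le {β θ D L : ℝ} (hθ0 : 0 ≤ θ) (hθ1 : θ ≤ 1) (hL : 0 < L)
    (hD0 : 0 ≤ D)
    (hD : ∀ r : ℝ, 0 ≤ r → r < 1 →
      ∫⁻ s in Set.Ioo r 1, ENNReal.ofReal ((1 - s) ^ (-β) * (s - r) ^ (-(β + θ))) ≤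
        ENNReal.ofReal (D * (1 - r) ^ (-β)))
    {Z : ℝ → ENNReal} (hZ : Measurable Z) :
    ∫⁻ s in Set.Ioo 0 1, ENNReal.ofReal ((1 - s) ^ (-β) * Real.exp (-L * s)) *
        ∫⁻ r in Set.Ioo 0 s, ENNReal.ofReal ((s - r) ^ (-β)) * Z r ≤
      ENNReal.ofReal (L ^ (-θ) * D) *
        ∫⁻ r in Set.Ioo 0 1, ENNReal.ofReal ((1 - r) ^ (-β) * Real.exp (-L * r)) * Z r := by
  let w : ℝ → ENNReal := fun s => ENNReal.ofReal ((1 - s) ^ (-β) * Real.exp (-L * s))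
  let k : ℝ → ℝ → ENNReal := fun s r => w s * (ENNReal.ofReal ((s - r) ^ (-β)) * Z r)
  have hw : Measurable w := by fun_prop
  have hk : Measurable (Function.uncurry k) := by
    simp only [k, Function.uncurry_def]
    fun_prop
  calc ∫⁻ s in Set.Ioo 0 1, w s * ∫⁻ r in Set.Ioo 0 s, ENNReal.ofReal ((s - r) ^ (-β)) * Z r
      = ∫⁻ s in Set.Ioo 0 1, ∫⁻ r in Set.Ioo 0 1,
          {x : ℝ × ℝ | x.2 < x.1}.indicator (Function.uncurry k) (s, r) := by
        refine setLIntegral_congr_fun measurableSet_Ioo fun s hs => ?_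
        have : Set.Ioo 0 s = Set.Iio s ∩ Set.Ioo 0 1 := by
          ext r
          simp only [Set.mem_Ioo, Set.mem_inter_iff, Set.mem_Iio]
          constructor
          · exact fun h => ⟨h.2, h.1, h.2.trans hs.2⟩
          · exact fun h => ⟨h.2.1, h.1⟩
        rw [← lintegral_const_mul _ (by fun_prop), this, ← setLIntegral_indicator measurableSet_Iio]
        rfl
    _ = ∫⁻ r in Set.Ioo 0 1, ∫⁻ s in Set.Ioo 0 1,
          {x : ℝ × ℝ | x.2 < x.1}.indicator (Function.uncurry k) (s, r) :=
        lintegral_lintegral_swap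
          (hk.indicator (measurableSet_lt measurable_snd measurable_fst)).aemeasurable
    _ ≤ ∫⁻ r in Set.Ioo 0 1, ENNReal.ofReal (L ^ (-θ) * D) * (w r * Z r) := by
        refine setLIntegral_mono' measurableSet_Ioo fun r hr => ?_
        have hset : Set.Ioi r ∩ Set.Ioo 0 1 = Set.Ioo r 1 := by
          ext s
          simp only [Set.mem_Ioo, Set.mem_inter_iff, Set.mem_Ioi]
          constructor
          · exact fun h => ⟨h.1, h.2.2⟩
          · exact fun h => ⟨h.1, hr.1.trans h.1, h.2⟩
        have hr1 : 0 < 1 - r := by linarith [hr.2]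
        calc ∫⁻ s in Set.Ioo 0 1, {x : ℝ × ℝ | x.2 < x.1}.indicator (Function.uncurry k) (s, r)
            = ∫⁻ s in Set.Ioo r 1, k s r := by
              rw [← hset, ← setLIntegral_indicator measurableSet_Ioi]
              rfl
          _ ≤ ∫⁻ s in Set.Ioo r 1, ENNReal.ofReal (L ^ (-θ) * Real.exp (-L * r)) *
                ENNReal.ofReal ((1 - s) ^ (-β) * (s - r) ^ (-(β + θ))) * Z r := by
              refine setLIntegral_mono' measurableSet_Ioo fun s hs => ?_
              have h1 : 0 < s - r := by linarith [hs.1]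
              have h2 : 0 < 1 - s := by linarith [hs.2]
              simp only [k, w]
              rw [← mul_assoc]
              refine mul_le_mul_left ?_ _
              rw [← ENNReal.ofReal_mul (by positivity), ← ENNReal.ofReal_mul (by positivity)]
              refine ENNReal.ofReal_le_ofReal ?_
              have hexp : Real.exp (-L * s) ≤
                  Real.exp (-L * r) * (L ^ (-θ) * (s - r) ^ (-θ)) := by
                rw [← Real.mul_rpow hL.le h1.le]
                have : -L * s = -L * r + -(L * (s - r)) := by ring
                rw [this, Real.exp_add]
                gcongr
                exact Real.exp_neg_le_rpow_neg hθ0 hθ1 (mul_pos hL h1)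
              calc (1 - s) ^ (-β) * Real.exp (-L * s) * (s - r) ^ (-β)
                  ≤ (1 - s) ^ (-β) * (Real.exp (-L * r) * (L ^ (-θ) * (s - r) ^ (-θ))) *
                      (s - r) ^ (-β) := by gcongr
                _ = _ := by
                  rw [neg_add, Real.rpow_add h1]
                  ring
          _ ≤ ENNReal.ofReal (L ^ (-θ) * Real.exp (-L * r)) *
                ENNReal.ofReal (D * (1 - r) ^ (-β)) * Z r := by
              rw [lintegral_mul_const _ (by fun_prop), lintegral_const_mul _ (by fun_prop)]
              gcongr
              exact hD r hr.1.le hr.2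
          _ = ENNReal.ofReal (L ^ (-θ) * D) * (w r * Z r) := by
              simp only [w]
              rw [← mul_assoc, ← ENNReal.ofReal_mul (by positivity),
                ← ENNReal.ofReal_mul (by positivity)]
              congr 2
              ring
    _ = _ := lintegral_const_mul _ (by fun_prop)

/-- A Gronwall bound on the unit interval for a single weakly singular kernel. -/
lemma exists_lintegral_gronwall_le {α β : ℝ} {N : ℕ} (hα0 : 0 ≤ α) (hα : α < 1) (hβ0 : 0 ≤ β)
    (hβ : β < 1) (hN : 1 < N * (1 - β)) :
    ∃ c > 0, ∀ A B : ℝ, 0 ≤ A → 0 < B → ∀ Z : ℝ → ENNReal, Measurable Z →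
      ∫⁻ r in Set.Ioo 0 1, ENNReal.ofReal ((1 - r) ^ (-β)) * Z r ≠ ⊤ →
      (∀ s ∈ Set.Ioo (0 : ℝ) 1, Z s ≤ ENNReal.ofReal (A * s ^ (-α)) +
        ENNReal.ofReal B * ∫⁻ r in Set.Ioo 0 s, ENNReal.ofReal ((s - r) ^ (-β)) * Z r) →
      ∫⁻ r in Set.Ioo 0 1, ENNReal.ofReal ((1 - r) ^ (-β)) * Z r ≤
        ENNReal.ofReal (c * A * Real.exp (c * B ^ N)) := by
  have hN0 : (0 : ℝ) < N := by
    by_contra h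
    nlinarith
  have hθ0 : 0 < (N : ℝ)⁻¹ := by positivity
  have hθ : (N : ℝ)⁻¹ < 1 - β := by
    rw [inv_lt_iff_one_lt_mul₀ hN0, mul_comm]
    exact hN
  obtain ⟨D, hD0, hD⟩ := exists_lintegral_beta_le (p := β + (N : ℝ)⁻¹) (q := β) (by positivity)
    (by linarith) hβ0 hβ
  obtain ⟨D', hD'0, hD'⟩ := exists_lintegral_beta_le hα0 hα hβ0 hβ
  refine ⟨2 * D' + (2 * D) ^ N, by positivity, fun A B hA hB Z hZ hfin hle => ?_⟩
  set L : ℝ := (2 * D * B) ^ N with hLdef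
  have hL : 0 < L := by positivity
  have hLθ : L ^ (-(N : ℝ)⁻¹) * D * B = 1 / 2 := by
    rw [Real.rpow_neg hL.le, hLdef,
      Real.pow_rpow_inv_natCast (by positivity) (by rintro rfl; simp at hN0)]
    field_simp
  set W : ENNReal :=
    ∫⁻ r in Set.Ioo 0 1, ENNReal.ofReal ((1 - r) ^ (-β) * Real.exp (-L * r)) * Z r with hW
  have hWfin : W ≠ ⊤ := by
    refine ne_top_of_le_ne_top hfin (setLIntegral_mono' measurableSet_Ioo fun r hr => ?_)
    have h1 : 0 < 1 - r := by linarith [hr.2]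
    gcongr
    refine mul_le_of_le_one_right (by positivity) (Real.exp_le_one_iff.2 ?_)
    nlinarith [hr.1]
  have hWle : W ≤ ENNReal.ofReal (A * D') + ENNReal.ofReal (1 / 2) * W := by
    calc W ≤ ∫⁻ s in Set.Ioo 0 1,
          (ENNReal.ofReal A * ENNReal.ofReal ((1 - s) ^ (-β) * (s - 0) ^ (-α)) +
          ENNReal.ofReal B * (ENNReal.ofReal ((1 - s) ^ (-β) * Real.exp (-L * s)) *
            ∫⁻ r in Set.Ioo 0 s, ENNReal.ofReal ((s - r) ^ (-β)) * Z r)) := by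
          refine setLIntegral_mono' measurableSet_Ioo fun s hs => ?_
          have h1 : 0 < 1 - s := by linarith [hs.2]
          have h0 : 0 < s := hs.1
          refine (mul_le_mul_right (hle s hs) _).trans ?_
          rw [mul_add, mul_left_comm _ (ENNReal.ofReal B)]
          refine add_le_add ?_ le_rfl
          rw [← ENNReal.ofReal_mul (by positivity), ← ENNReal.ofReal_mul hA, sub_zero]
          refine ENNReal.ofReal_le_ofReal ?_
          have : Real.exp (-L * s) ≤ 1 := Real.exp_le_one_iff.2 (by nlinarith)
          calc (1 - s) ^ (-β) * Real.exp (-L * s) * (A * s ^ (-α))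
              ≤ (1 - s) ^ (-β) * 1 * (A * s ^ (-α)) := by gcongr
            _ = _ := by ring
      _ = ENNReal.ofReal A *
            (∫⁻ s in Set.Ioo 0 1, ENNReal.ofReal ((1 - s) ^ (-β) * (s - 0) ^ (-α))) +
          ENNReal.ofReal B *
            ∫⁻ s in Set.Ioo 0 1, ENNReal.ofReal ((1 - s) ^ (-β) * Real.exp (-L * s)) *
              ∫⁻ r in Set.Ioo 0 s, ENNReal.ofReal ((s - r) ^ (-β)) * Z r := by
          rw [lintegral_add_left (by fun_prop), lintegral_const_mul _ (by fun_prop),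
            lintegral_const_mul' _ _ ENNReal.ofReal_ne_top]
      _ ≤ ENNReal.ofReal A * ENNReal.ofReal (D' * (1 - 0) ^ (-β)) +
          ENNReal.ofReal B * (ENNReal.ofReal (L ^ (-(N : ℝ)⁻¹) * D) * W) := by
          gcongr
          · exact hD' 0 le_rfl zero_lt_one
          · exact lintegral_weight_mul_volterra_le hθ0.le (by linarith) hL hD0.le hD hZ
      _ = _ := by
          rw [← mul_assoc, ← ENNReal.ofReal_mul hA, ← ENNReal.ofReal_mul hB.le, mul_comm B, hLθ]
          simp
  have hWreal : W ≤ ENNReal.ofReal (2 * D' * A) := by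
    rw [← ENNReal.ofReal_toReal hWfin, ← ENNReal.ofReal_mul (by norm_num),
      ← ENNReal.ofReal_add (by positivity) (by positivity),
      ENNReal.ofReal_le_ofReal_iff (by positivity)] at hWle
    rw [← ENNReal.ofReal_toReal hWfin]
    exact ENNReal.ofReal_le_ofReal (by linarith)
  calc ∫⁻ r in Set.Ioo 0 1, ENNReal.ofReal ((1 - r) ^ (-β)) * Z r
      ≤ ∫⁻ r in Set.Ioo 0 1, ENNReal.ofReal (Real.exp L) *
          (ENNReal.ofReal ((1 - r) ^ (-β) * Real.exp (-L * r)) * Z r) := by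
        refine setLIntegral_mono' measurableSet_Ioo fun r hr => ?_
        have h1 : 0 < 1 - r := by linarith [hr.2]
        rw [← mul_assoc, ← ENNReal.ofReal_mul (by positivity), mul_left_comm, ← Real.exp_add]
        gcongr
        refine le_mul_of_one_le_right (by positivity) (Real.one_le_exp ?_)
        nlinarith
    _ = ENNReal.ofReal (Real.exp L) * W := lintegral_const_mul' _ _ ENNReal.ofReal_ne_top
    _ ≤ ENNReal.ofReal (Real.exp L) * ENNReal.ofReal (2 * D' * A) := by gcongr
    _ ≤ _ := by
        rw [← ENNReal.ofReal_mul (by positivity)]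
        refine ENNReal.ofReal_le_ofReal ?_
        rw [mul_comm, hLdef, mul_pow]
        gcongr
        · exact le_add_of_nonneg_right (by positivity)
        · exact le_add_of_nonneg_left (by positivity)

lemma integrableOn_rpow_neg_mul {β : ℝ} (hβ : β < 1) {z : ℝ → ℝ}
    (hzc : ContinuousOn z (Set.Ioc 0 1)) (hzi : IntegrableOn z (Set.Ioc 0 1)) :
    IntegrableOn (fun r => (1 - r) ^ (-β) * z r) (Set.Ioo 0 1) := by
  have hleft : IntegrableOn (fun r => (1 - r) ^ (-β) * z r) (Set.Ioc 0 (1 / 2)) := by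
    refine IntegrableOn.continuousOn_mul_of_subset (K := Set.Icc (0 : ℝ) (1 / 2)) ?_
      (hzi.mono_set (Set.Ioc_subset_Ioc_right (by norm_num))) isCompact_Icc measurableSet_Ioc
      Set.Ioc_subset_Icc_self
    refine ContinuousOn.rpow_const (by fun_prop) fun r hr => Or.inl ?_
    linarith [hr.2]
  have hright : IntegrableOn (fun r => (1 - r) ^ (-β) * z r) (Set.Ioo (1 / 2) 1) := by
    refine IntegrableOn.mul_continuousOn_of_subset (K := Set.Icc (1 / 2 : ℝ) 1)
      (integrableOn_Ioo_const_sub_rpow_neg hβ (by norm_num)) (hzc.mono fun r hr => ?_)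
      measurableSet_Ioo isCompact_Icc Set.Ioo_subset_Icc_self
    exact ⟨by linarith [hr.1], hr.2⟩
  rw [← Set.Ioc_union_Ioo_eq_Ioo (by norm_num : (0 : ℝ) ≤ 1 / 2) (by norm_num : (1 / 2 : ℝ) < 1)]
  exact hleft.union hright

/-- Volterra integrals with power kernels are homogeneous under dilations. -/
lemma setIntegral_volterra_rescale {β t s : ℝ} (ht : 0 < t) (hs : 0 < s) (y : ℝ → ℝ) :
    ∫ r in Set.Ioo 0 (t * s), (t * s - r) ^ (-β) * y r =
      t ^ (1 - β) * ∫ r in Set.Ioo 0 s, (s - r) ^ (-β) * y (t * r) := by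
  have h := intervalIntegral.integral_comp_mul_left (a := 0) (b := s)
    (fun r => (t * s - r) ^ (-β) * y r) ht.ne'
  rw [mul_zero, intervalIntegral.integral_of_le hs.le,
    intervalIntegral.integral_of_le (mul_pos ht hs).le, integral_Ioc_eq_integral_Ioo,
    integral_Ioc_eq_integral_Ioo, smul_eq_mul, eq_inv_mul_iff_mul_eq₀ ht.ne'] at h
  rw [← h, sub_eq_add_neg, Real.rpow_add ht, Real.rpow_one, mul_assoc,
    ← integral_const_mul (t ^ (-β))]
  congr 1
  refine setIntegral_congr_fun measurableSet_Ioo fun r hr => ?_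
  have : 0 ≤ s - r := by linarith [hr.2]
  rw [← mul_sub, Real.mul_rpow ht.le this, mul_assoc]

lemma ofReal_setIntegral_volterra_le {β γ s : ℝ} (hβγ : β ≤ γ) (hs1 : s ≤ 1) {z : ℝ → ℝ}
    (hz : ∀ r ∈ Set.Ioo 0 s, 0 ≤ z r) :
    ENNReal.ofReal (∫ r in Set.Ioo 0 s, (s - r) ^ (-β) * z r) ≤
      ∫⁻ r in Set.Ioo 0 s, ENNReal.ofReal ((s - r) ^ (-γ)) * ENNReal.ofReal (z r) := by
  refine (Real.ofReal_le_enorm _).trans ((enorm_integral_le_lintegral_enorm _).trans ?_)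
  refine setLIntegral_mono' measurableSet_Ioo fun r hr => ?_
  have h0 : 0 < s - r := by linarith [hr.2]
  have hzr := hz r hr
  rw [Real.enorm_of_nonneg (by positivity), ← ENNReal.ofReal_mul (by positivity)]
  refine ENNReal.ofReal_le_ofReal ?_
  gcongr ?_ * _
  exact Real.rpow_le_rpow_of_exponent_ge h0 (by linarith [hr.1]) (by linarith)

lemma one_lt_nBeta_add_one_mul {m : ℕ} (β : Fin (m + 1) → ℝ)
    (hβ : Finset.univ.sup' ⟨0, Finset.mem_univ 0⟩ β < 1) :
    1 < ((nBeta β + 1 : ℕ) : ℝ) * (1 - Finset.univ.sup' ⟨0, Finset.mem_univ 0⟩ β) := by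
  simp only [nBeta]
  set b := Finset.univ.sup' ⟨0, Finset.mem_univ 0⟩ β
  have hb : 0 < 1 - b := by linarith
  have h := (div_lt_iff₀ hb).1 (Nat.lt_floor_add_one (b / (1 - b)))
  push_cast
  nlinarith

/-- Absorbing the linear factor `B` into a polynomial of degree at least one and the exponential
into `1 + x * exp (c * x)`. -/
lemma add_mul_exp_le_gronwall_form {c A B : ℝ} {n : ℕ} (hc : 0 < c) (hA : 0 ≤ A) (hB : 0 ≤ B)
    (hn : 1 ≤ n) :
    A + B * (c * A * Real.exp (c * B ^ (n + 1))) ≤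
      (1 + c) ^ 2 * A * (1 + B ^ (n + 1) * Real.exp ((1 + c) ^ 2 * B ^ (n + 1))) *
        ∑ k ∈ Finset.range (n + 1), B ^ k := by
  set x := B ^ (n + 1)
  set S := ∑ k ∈ Finset.range (n + 1), B ^ k with hS
  have hx : 0 ≤ x := by positivity
  have hS1 : 1 ≤ S := by
    simpa using Finset.single_le_sum (f := fun k => B ^ k) (fun k _ => pow_nonneg hB k)
      (Finset.mem_range.2 (by lia : 0 < n + 1))
  have hSB : B ≤ S := by
    simpa using Finset.single_le_sum (f := fun k => B ^ k) (fun k _ => pow_nonneg hB k)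
      (Finset.mem_range.2 (by lia : 1 < n + 1))
  set E := Real.exp (c * x) with hE
  have hE1 : 1 ≤ E := Real.one_le_exp (by positivity)
  have hE2 : E ≤ 1 + c * x * E := by
    have h := Real.add_one_le_exp (-(c * x))
    have h' : Real.exp (-(c * x)) * E = 1 := by rw [hE, ← Real.exp_add]; simp
    nlinarith
  have hEE : E ≤ Real.exp ((1 + c) ^ 2 * x) := by
    rw [hE]
    gcongr
    nlinarith
  calc A + B * (c * A * E) ≤ A * (S * E) + S * (c * A * E) := by
        gcongr
        exact le_mul_of_one_le_right hA (one_le_mul_of_one_le_of_one_le hS1 hE1)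
    _ = (1 + c) * A * E * S := by ring
    _ ≤ (1 + c) * A * ((1 + c) * (1 + x * E)) * S := by
        gcongr
        nlinarith [mul_nonneg hx (by linarith : 0 ≤ E)]
    _ = (1 + c) ^ 2 * A * (1 + x * E) * S := by ring
    _ ≤ _ := by gcongr

/-- Generalized Gronwall lemma with weakly singular kernels: if a nonnegative continuous
integrable `y` on `(0,T]` satisfies
`y(t) ≤ Σᵢ aᵢ t^{-αᵢ} + Σⱼ bⱼ ∫₀ᵗ (t−s)^{-βⱼ} y(s) ds`, then with `B_k(t) = (Σⱼ bⱼ t^{1-βⱼ})^k`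
and `n_β = ⌊β/(1−β)⌋ + 1`, `β = maxⱼ βⱼ`, there is a constant `C` depending only on the `αᵢ`
and `βⱼ` with
`y(t) ≤ C (Σᵢ aᵢ t^{-αᵢ}) (1 + B_{n_β+1}(t) e^{C B_{n_β+1}(t)}) Σ_{k=0}^{n_β} B_k(t)`. -/
theorem generalized_gronwall (l m : ℕ) (α : Fin (l + 1) → ℝ) (β : Fin (m + 1) → ℝ)
    (hα : ∀ i, 0 ≤ α i ∧ α i < 1) (hβ : ∀ j, 0 ≤ β j ∧ β j < 1) :
    ∃ C > 0, ∀ T : ℝ, 0 < T → ∀ (a : Fin (l + 1) → ℝ) (b : Fin (m + 1) → ℝ),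
      (∀ i, 0 < a i) → (∀ j, 0 < b j) → ∀ y : ℝ → ℝ,
      ContinuousOn y (Set.Ioc 0 T) → IntegrableOn y (Set.Ioc 0 T) →
      (∀ t ∈ Set.Ioc (0 : ℝ) T, 0 ≤ y t) →
      (∀ t ∈ Set.Ioc (0 : ℝ) T,
        y t ≤ (∑ i, a i * t ^ (-(α i))) +
          ∑ j, b j * ∫ s in Set.Ioo 0 t, (t - s) ^ (-(β j)) * y s) →
      ∀ t ∈ Set.Ioc (0 : ℝ) T,
        y t ≤ C * (∑ i, a i * t ^ (-(α i))) *
          (1 + (∑ j, b j * t ^ (1 - β j)) ^ (nBeta β + 1) *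
            Real.exp (C * (∑ j, b j * t ^ (1 - β j)) ^ (nBeta β + 1))) *
          ∑ k ∈ Finset.range (nBeta β + 1), (∑ j, b j * t ^ (1 - β j)) ^ k := by
  have hα0 : 0 ≤ Finset.univ.sup' ⟨0, Finset.mem_univ 0⟩ α :=
    (hα 0).1.trans (Finset.le_sup' α (Finset.mem_univ 0))
  have hα1 : Finset.univ.sup' ⟨0, Finset.mem_univ 0⟩ α < 1 :=
    (Finset.sup'_lt_iff _).2 fun i _ => (hα i).2
  have hβ0 : 0 ≤ Finset.univ.sup' ⟨0, Finset.mem_univ 0⟩ β :=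
    (hβ 0).1.trans (Finset.le_sup' β (Finset.mem_univ 0))
  have hβ1 : Finset.univ.sup' ⟨0, Finset.mem_univ 0⟩ β < 1 :=
    (Finset.sup'_lt_iff _).2 fun j _ => (hβ j).2
  obtain ⟨c, hc, hgron⟩ := exists_lintegral_gronwall_le hα0 hα1 hβ0 hβ1
    (one_lt_nBeta_add_one_mul β hβ1)
  have hle_α : ∀ i, α i ≤ Finset.univ.sup' ⟨0, Finset.mem_univ 0⟩ α :=
    fun i => Finset.le_sup' α (Finset.mem_univ i)
  have hle_β : ∀ j, β j ≤ Finset.univ.sup' ⟨0, Finset.mem_univ 0⟩ β :=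
    fun j => Finset.le_sup' β (Finset.mem_univ j)
  set p := Finset.univ.sup' ⟨0, Finset.mem_univ 0⟩ α
  set q := Finset.univ.sup' ⟨0, Finset.mem_univ 0⟩ β
  refine ⟨(1 + c) ^ 2, by positivity, fun T hT a b ha hb y hyc hyi hy0 hy t ht => ?_⟩
  have ht0 : 0 < t := ht.1
  set A := ∑ i, a i * t ^ (-(α i)) with hAdef
  set B := ∑ j, b j * t ^ (1 - β j) with hBdef
  have hA : 0 ≤ A := Finset.sum_nonneg fun i _ => by have := ha i; positivity
  have hB : 0 < B := Finset.sum_pos (fun j _ => by have := hb j; positivity) ⟨0, Finset.mem_univ 0⟩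
  have hmem : ∀ s ∈ Set.Ioc (0 : ℝ) 1, t * s ∈ Set.Ioc (0 : ℝ) T := fun s hs =>
    ⟨mul_pos ht0 hs.1, (mul_le_of_le_one_right ht0.le hs.2).trans ht.2⟩
  have hzc : ContinuousOn (fun s => y (t * s)) (Set.Ioc 0 1) :=
    hyc.comp (by fun_prop) hmem
  have hzi : IntegrableOn (fun s => y (t * s)) (Set.Ioc 0 1) := by
    rw [← intervalIntegrable_iff_integrableOn_Ioc_of_le zero_le_one]
    have h : IntervalIntegrable y volume 0 t :=
      (intervalIntegrable_iff_integrableOn_Ioc_of_le ht0.le).2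
        (hyi.mono_set (Set.Ioc_subset_Ioc_right ht.2))
    simpa [ht0.ne'] using h.comp_mul_left (c := t)
  set Z : ℝ → ENNReal :=
    fun s => ENNReal.ofReal ((Set.Ioo (0 : ℝ) 1).indicator (fun s => y (t * s)) s) with hZdef
  have hZ : Measurable Z := by
    classical
    refine Measurable.ennreal_ofReal ?_
    rw [← Set.piecewise_eq_indicator]
    exact (hzc.mono Set.Ioo_subset_Ioc_self).measurable_piecewise continuousOn_const
      measurableSet_Ioo
  have hZ_eq : ∀ s ∈ Set.Ioo (0 : ℝ) 1, Z s = ENNReal.ofReal (y (t * s)) := fun s hs => by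
    rw [hZdef]
    simp only [Set.indicator_of_mem hs]
  have hmain : ∀ s ∈ Set.Ioc (0 : ℝ) 1, ENNReal.ofReal (y (t * s)) ≤
      ENNReal.ofReal (A * s ^ (-p)) +
        ENNReal.ofReal B * ∫⁻ r in Set.Ioo 0 s, ENNReal.ofReal ((s - r) ^ (-q)) * Z r := by
    intro s hs
    have hs0 : 0 < s := hs.1
    have hz0 : ∀ r ∈ Set.Ioo 0 s, 0 ≤ y (t * r) := fun r hr =>
      hy0 _ (hmem r ⟨hr.1, hr.2.le.trans hs.2⟩)
    have hJ : ∀ j, 0 ≤ ∫ r in Set.Ioo 0 s, (s - r) ^ (-(β j)) * y (t * r) := fun j =>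
      setIntegral_nonneg measurableSet_Ioo fun r hr =>
        mul_nonneg (Real.rpow_nonneg (by linarith [hr.2]) _) (hz0 r hr)
    refine (ENNReal.ofReal_le_ofReal (hy _ (hmem s hs))).trans
      (ENNReal.ofReal_add_le.trans (add_le_add ?_ ?_))
    · refine ENNReal.ofReal_le_ofReal ?_
      rw [hAdef, Finset.sum_mul]
      refine Finset.sum_le_sum fun i _ => ?_
      have := ha i
      rw [Real.mul_rpow ht0.le hs0.le, ← mul_assoc]
      gcongr _ * ?_
      exact Real.rpow_le_rpow_of_exponent_ge hs0 hs.2 (by linarith [hle_α i])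
    · simp_rw [setIntegral_volterra_rescale ht0 hs0, ← mul_assoc]
      rw [ENNReal.ofReal_sum_of_nonneg (fun j _ => by have := hb j; have := hJ j; positivity),
        hBdef, ENNReal.ofReal_sum_of_nonneg (fun j _ => by have := hb j; positivity),
        Finset.sum_mul]
      refine Finset.sum_le_sum fun j _ => ?_
      have := hb j
      rw [ENNReal.ofReal_mul (by positivity)]
      gcongr
      refine (ofReal_setIntegral_volterra_le (hle_β j) hs.2 hz0).trans
        (setLIntegral_mono' measurableSet_Ioo fun r hr => ?_)
      rw [hZ_eq r ⟨hr.1, hr.2.trans_le hs.2⟩]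
  have hfin : ∫⁻ r in Set.Ioo 0 1, ENNReal.ofReal ((1 - r) ^ (-q)) * Z r ≠ ⊤ := by
    refine ne_top_of_le_ne_top (integrableOn_rpow_neg_mul hβ1 hzc hzi).setLIntegral_lt_top.ne
      (setLIntegral_mono' measurableSet_Ioo fun r hr => ?_)
    have : 0 ≤ 1 - r := by linarith [hr.2]
    rw [hZ_eq r hr, ← ENNReal.ofReal_mul (by positivity)]
  have hV := hgron A B hA hB Z hZ hfin fun s hs =>
    (hZ_eq s hs).trans_le (hmain s (Set.Ioo_subset_Ioc_self hs))
  have hfinal : y t ≤ A + B * (c * A * Real.exp (c * B ^ (nBeta β + 1))) := by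
    have h := hmain 1 ⟨zero_lt_one, le_rfl⟩
    rw [mul_one, Real.one_rpow, mul_one] at h
    refine (ENNReal.ofReal_le_ofReal_iff (by positivity)).1 (h.trans ?_)
    rw [ENNReal.ofReal_add hA (by positivity), ENNReal.ofReal_mul hB.le]
    gcongr
  exact hfinal.trans (add_mul_exp_le_gronwall_form hc hA hB.le (Nat.le_add_left 1 _))
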